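/- Suppose the pair (ι, λ) is ample, i.e. 0̄ ∈ Σ_ι[λ]. Let w = s_{i_L}⋯s_{i_1} be a reduced word in the Weyl group W of A whose letters i_1,…,i_L are the first L terms of ι, and let D_L be the subset of ℤ^∞_ι[λ] obtained from {0̄} by successively closing under the powers of f̃_{i_1}, …, f̃_{i_L} and removing 0. Then D_L = { x ∈ ℤ^∞ : φ(x) ≥ 0 for every φ ∈ Ξ_ι[λ], and x_k = 0 for all k > L }. In particular D_L (the image of the Demazure crystal B_w(λ)) is the set of lattice points of a convex polytope. -/

import Mathlib

noncomputable section

namespace PaperNakashima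

variable {I : Type*} [DecidableEq I]

/-- `σ_k(x) = x_k + Σ_{j>k} a_{i_k i_j} x_j`. -/
def sig (A : I → I → ℤ) (ι : ℕ → I) (k : ℕ) (x : ℕ →₀ ℤ) : ℤ :=
  x k + ∑ j ∈ x.support.filter (fun j => k < j), A (ι k) (ι j) * x j

/-- `σ_0^{(i)}(x) = -λ_i + Σ_{j≥1} a_{i i_j} x_j`. -/
def sig0 (A : I → I → ℤ) (ι : ℕ → I) (lam : I → ℤ) (i : I) (x : ℕ →₀ ℤ) : ℤ :=
  -lam i + ∑ j ∈ x.support.filter (fun j => 1 ≤ j), A i (ι j) * x j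

/-- `σ^{(i)}(x) = max_{k ≥ 1, i_k = i} σ_k(x)`. -/
def sigMax (A : I → I → ℤ) (ι : ℕ → I) (i : I) (x : ℕ →₀ ℤ) : ℤ :=
  sSup ((fun k => sig A ι k x) '' {k | 1 ≤ k ∧ ι k = i})

/-- `M^{(i)}(x) = {k ≥ 1 : i_k = i, σ_k(x) = σ^{(i)}(x)}`. -/
def Mset (A : I → I → ℤ) (ι : ℕ → I) (i : I) (x : ℕ →₀ ℤ) : Set ℕ :=
  {k | 1 ≤ k ∧ ι k = i ∧ sig A ι k x = sigMax A ι i x}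

/-- The Kashiwara operator `f̃_i` on `ℤ^∞_ι[λ] ⊔ {0}`, with `none` playing the role of `0`. -/
def ftil (A : I → I → ℤ) (ι : ℕ → I) (lam : I → ℤ) (i : I) :
    Option (ℕ →₀ ℤ) → Option (ℕ →₀ ℤ)
  | none => none
  | some x =>
    if sig0 A ι lam i x < sigMax A ι i x then
      some (x + Finsupp.single (sInf (Mset A ι i x)) 1)
    else none

/-- The Kashiwara operator `ẽ_i` on `ℤ^∞_ι[λ] ⊔ {0}`. -/
def etil (A : I → I → ℤ) (ι : ℕ → I) (lam : I → ℤ) (i : I) :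
    Option (ℕ →₀ ℤ) → Option (ℕ →₀ ℤ)
  | none => none
  | some x =>
    if 0 < sigMax A ι i x ∧ sig0 A ι lam i x ≤ sigMax A ι i x then
      some (x - Finsupp.single (sSup (Mset A ι i x)) 1)
    else none

/-- `ε_i(x) = max(σ^{(i)}(x), σ_0^{(i)}(x))`. -/
def eps (A : I → I → ℤ) (ι : ℕ → I) (lam : I → ℤ) (i : I) (x : ℕ →₀ ℤ) : ℤ :=
  max (sigMax A ι i x) (sig0 A ι lam i x)

/-- `φ_i(x) = ε_i(x) - σ_0^{(i)}(x) = ⟨h_i, wt(x)⟩ + ε_i(x)`. -/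
def phi (A : I → I → ℤ) (ι : ℕ → I) (lam : I → ℤ) (i : I) (x : ℕ →₀ ℤ) : ℤ :=
  eps A ι lam i x - sig0 A ι lam i x

/-- `F(λ)`: the image of `B(λ)` under the Kashiwara embedding, i.e. all nonzero elements
obtained from the highest weight element `0̄` by applying Kashiwara operators `f̃`. -/
def FSet (A : I → I → ℤ) (ι : ℕ → I) (lam : I → ℤ) : Set (ℕ →₀ ℤ) :=
  {x | ∃ l : List I, List.foldl (fun y i => ftil A ι lam i y) (some 0) l = some x}

/-- The Demazure subsets `D_k`: `D_0 = {0̄}` and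
`D_k = { f̃_{i_k}^m(x) : m ≥ 0, x ∈ D_{k-1} } \ {0}`. -/
def Dem (A : I → I → ℤ) (ι : ℕ → I) (lam : I → ℤ) : ℕ → Set (ℕ →₀ ℤ)
  | 0 => {0}
  | (k+1) => {y | ∃ m : ℕ, ∃ x ∈ Dem A ι lam k,
      (ftil A ι lam (ι (k+1)))^[m] (some x) = some y}

/-- The Coxeter matrix entry attached to a generalized Cartan matrix:
`m_{ij} = 2, 3, 4, 6, ∞(=0)` according as `a_{ij} a_{ji} = 0, 1, 2, 3, ≥ 4`. -/
def coxEntry (A : I → I → ℤ) (i j : I) : ℕ :=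
  if i = j then 1
  else if A i j * A j i = 0 then 2
  else if A i j * A j i = 1 then 3
  else if A i j * A j i = 2 then 4
  else if A i j * A j i = 3 then 6
  else 0

/-- The Coxeter matrix of the Weyl group of a generalized Cartan matrix `A`. -/
def coxOf (A : I → I → ℤ) : CoxeterMatrix I where
  M := Matrix.of fun i j => coxEntry A i j
  isSymm := by
    ext i j
    by_cases h : i = j
    · simp [coxEntry, h]
    · simp only [Matrix.transpose_apply, Matrix.of_apply, coxEntry, if_neg h,
        if_neg (Ne.symm h), mul_comm (A i j) (A j i)]
  diagonal i := by simp [coxEntry]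
  off_diagonal i j h := by
    simp only [Matrix.of_apply, coxEntry, if_neg h]
    split_ifs <;> decide

/-- The word `i_L, i_{L-1}, …, i_1` (the first `L` letters of `ι`, read backwards). -/
def demWord (ι : ℕ → I) (L : ℕ) : List I :=
  (List.range L).map (fun k => ι (L - k))

/-- `k^{(-)} = max { l : 1 ≤ l < k, i_l = i_k }` (`0` if there is no such `l`). -/
def kminus (ι : ℕ → I) (k : ℕ) : ℕ :=
  sSup {l | 1 ≤ l ∧ l < k ∧ ι l = ι k}

/-- `k^{(+)} = min { l : l > k, i_l = i_k }`. -/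
def kplus (ι : ℕ → I) (k : ℕ) : ℕ :=
  sInf {l | k < l ∧ ι l = ι k}

/-- The affine-linear function `β_k^{(+)}(x) = x_k + Σ_{k<j<k^{(+)}} a_{i_k i_j} x_j + x_{k^{(+)}}`,
encoded as a pair (constant term, finitely supported coefficient vector). -/
def betaP (A : I → I → ℤ) (ι : ℕ → I) (k : ℕ) : ℤ × (ℕ →₀ ℤ) :=
  (0, Finsupp.single k 1 + Finsupp.single (kplus ι k) 1 +
    ∑ j ∈ Finset.Ioo k (kplus ι k), Finsupp.single j (A (ι k) (ι j)))

/-- The affine-linear function `β_k^{(-)}`: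
`β_k^{(-)}(x) = x_{k^{(-)}} + Σ_{k^{(-)}<j<k} a_{i_k i_j} x_j + x_k` if `k^{(-)} > 0`, and
`β_k^{(-)}(x) = -λ_{i_k} + Σ_{1≤j<k} a_{i_k i_j} x_j + x_k` if `k^{(-)} = 0`. -/
def betaM (A : I → I → ℤ) (ι : ℕ → I) (lam : I → ℤ) (k : ℕ) : ℤ × (ℕ →₀ ℤ) :=
  if kminus ι k = 0 then
    (-lam (ι k), (∑ j ∈ Finset.Ioo 0 k, Finsupp.single j (A (ι k) (ι j))) + Finsupp.single k 1)
  else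
    (0, Finsupp.single (kminus ι k) 1 +
      (∑ j ∈ Finset.Ioo (kminus ι k) k, Finsupp.single j (A (ι k) (ι j))) + Finsupp.single k 1)

/-- The affine-linear function
`λ^{(i)}(x) = λ_i − Σ_{1≤j<ι^{(i)}} a_{i i_j} x_j − x_{ι^{(i)}}`, where `ι^{(i)}` is the first
position `k ≥ 1` with `i_k = i`. -/
def lamF (A : I → I → ℤ) (ι : ℕ → I) (lam : I → ℤ) (i : I) : ℤ × (ℕ →₀ ℤ) :=
  (lam i, -(∑ j ∈ Finset.Ioo 0 (sInf {k | 1 ≤ k ∧ ι k = i}), Finsupp.single j (A i (ι j)))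
    - Finsupp.single (sInf {k | 1 ≤ k ∧ ι k = i}) 1)

/-- The operator `Ŝ_k`: `Ŝ_k(φ) = φ − φ_k β_k^{(+)}` if `φ_k > 0`, and
`Ŝ_k(φ) = φ − φ_k β_k^{(-)}` if `φ_k ≤ 0`. -/
def Shat (A : I → I → ℤ) (ι : ℕ → I) (lam : I → ℤ) (k : ℕ) (φ : ℤ × (ℕ →₀ ℤ)) :
    ℤ × (ℕ →₀ ℤ) :=
  if 0 < φ.2 k then
    (φ.1 - φ.2 k * (betaP A ι k).1, φ.2 - φ.2 k • (betaP A ι k).2)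
  else
    (φ.1 - φ.2 k * (betaM A ι lam k).1, φ.2 - φ.2 k • (betaM A ι lam k).2)

/-- The set `Ξ_ι[λ]` of affine-linear functions obtained from the coordinate functions
`x_j` (`j ≥ 1`) and the `λ^{(i)}` (`i ∈ I`) by applying finitely many operators `Ŝ_k` (`k ≥ 1`). -/
inductive XiLam (A : I → I → ℤ) (ι : ℕ → I) (lam : I → ℤ) : ℤ × (ℕ →₀ ℤ) → Prop
  | coord (j : ℕ) (hj : 1 ≤ j) : XiLam A ι lam (0, Finsupp.single j 1)
  | lamgen (i : I) : XiLam A ι lam (lamF A ι lam i)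
  | shat (k : ℕ) (hk : 1 ≤ k) (φ : ℤ × (ℕ →₀ ℤ)) (hφ : XiLam A ι lam φ) :
      XiLam A ι lam (Shat A ι lam k φ)

/-- Evaluation of an affine-linear function `φ(x) = c + Σ_k φ_k x_k` at `x`. -/
def evalAff (φ : ℤ × (ℕ →₀ ℤ)) (x : ℕ →₀ ℤ) : ℤ :=
  φ.1 + ∑ j ∈ φ.2.support, φ.2 j * x j

/-- The lattice points of `Σ_ι[λ]`: every function of `Ξ_ι[λ]` is nonnegative at `x`. -/
def InSigma (A : I → I → ℤ) (ι : ℕ → I) (lam : I → ℤ) (x : ℕ →₀ ℤ) : Prop :=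
  ∀ φ, XiLam A ι lam φ → 0 ≤ evalAff φ x

lemma evalAff_eq (φ : ℤ × (ℕ →₀ ℤ)) (x : ℕ →₀ ℤ) :
    evalAff φ x = φ.1 + Finsupp.linearCombination ℤ x φ.2 := by
  simp [evalAff, Finsupp.linearCombination_apply, Finsupp.sum]

lemma evalAff_add_single (φ : ℤ × (ℕ →₀ ℤ)) (x : ℕ →₀ ℤ) (k : ℕ) (c : ℤ) :
    evalAff φ (x + Finsupp.single k c) = evalAff φ x + φ.2 k * c := by
  have h : ∑ j ∈ φ.2.support, φ.2 j * Finsupp.single k c j = φ.2 k * c := by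
    rw [Finset.sum_eq_single k]
    · simp
    · intro j _ hj
      simp [Finsupp.single_eq_of_ne hj]
    · intro hk
      simp [Finsupp.notMem_support_iff.mp hk]
  simp only [evalAff, Finsupp.add_apply, mul_add, Finset.sum_add_distrib, h, add_assoc]

lemma evalAff_sub_smul (φ β : ℤ × (ℕ →₀ ℤ)) (c : ℤ) (x : ℕ →₀ ℤ) :
    evalAff (φ.1 - c * β.1, φ.2 - c • β.2) x = evalAff φ x - c * evalAff β x := by
  simp only [evalAff_eq, map_sub, map_smul, smul_eq_mul]
  ring

lemma sum_support_filter_eq (x : ℕ →₀ ℤ) (c : ℕ → ℤ) {k N : ℕ}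
    (hN : ∀ j, N ≤ j → x j = 0) :
    ∑ j ∈ x.support.filter (fun j => k < j), c j * x j = ∑ j ∈ Finset.Ioo k N, c j * x j := by
  apply Finset.sum_subset
  · intro j hj
    simp only [Finset.mem_filter, Finsupp.mem_support_iff, Finset.mem_Ioo] at hj ⊢
    refine ⟨hj.2, ?_⟩
    by_contra h
    exact hj.1 (hN j (by omega))
  · intro j hj hj'
    simp only [Finset.mem_filter, Finsupp.mem_support_iff, Finset.mem_Ioo] at hj hj'
    have : x j = 0 := by
      by_contra h
      exact hj' ⟨h, hj.1⟩
    simp [this]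

lemma exists_vanishing_bound (x : ℕ →₀ ℤ) (n : ℕ) : ∃ N, n < N ∧ ∀ j, N ≤ j → x j = 0 := by
  refine ⟨max (n + 1) (x.support.sup id + 1), by omega, fun j hj => ?_⟩
  by_contra h
  have : j ≤ x.support.sup id :=
    Finset.le_sup (f := id) (Finsupp.mem_support_iff.mpr h)
  omega

lemma sum_Ioo_split (f : ℕ → ℤ) {k l N : ℕ} (hkl : k < l) (hlN : l < N) :
    ∑ j ∈ Finset.Ioo k N, f j =
      ∑ j ∈ Finset.Ioo k l, f j + f l + ∑ j ∈ Finset.Ioo l N, f j := by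
  have h : Finset.Ioo k N = (Finset.Ioo k l ∪ {l}) ∪ Finset.Ioo l N := by
    ext j
    simp only [Finset.mem_Ioo, Finset.mem_union, Finset.mem_singleton]
    omega
  rw [h, Finset.sum_union, Finset.sum_union, Finset.sum_singleton]
  · simp
  · rw [Finset.disjoint_left]
    intro j hj
    simp only [Finset.mem_Ioo, Finset.mem_union, Finset.mem_singleton] at hj ⊢
    omega

lemma sig_sub_sig {A : I → I → ℤ} (hA : ∀ i, A i i = 2) {ι : ℕ → I} (x : ℕ →₀ ℤ) {k l : ℕ}
    (hkl : k < l) (hι : ι k = ι l) :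
    sig A ι k x - sig A ι l x =
      x k + ∑ j ∈ Finset.Ioo k l, A (ι k) (ι j) * x j + x l := by
  obtain ⟨N, hlN, hN⟩ := exists_vanishing_bound x l
  rw [sig, sig, sum_support_filter_eq x _ hN, sum_support_filter_eq x _ hN,
    sum_Ioo_split _ hkl hlN, ← hι, hA]
  ring

lemma sig0_sub_sig {A : I → I → ℤ} (hA : ∀ i, A i i = 2) {ι : ℕ → I} (lam : I → ℤ)
    (x : ℕ →₀ ℤ) {k : ℕ} (hk : 1 ≤ k) :
    sig0 A ι lam (ι k) x - sig A ι k x =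
      -lam (ι k) + ∑ j ∈ Finset.Ioo 0 k, A (ι k) (ι j) * x j + x k := by
  obtain ⟨N, hkN, hN⟩ := exists_vanishing_bound x k
  have h0 := sum_support_filter_eq x (fun j => A (ι k) (ι j)) (k := 0) hN
  rw [sum_Ioo_split _ hk hkN, hA] at h0
  have hf : x.support.filter (fun j => 1 ≤ j) = x.support.filter (fun j => 0 < j) := rfl
  rw [sig, sig0, sum_support_filter_eq x _ hN, hf, h0]
  ring

lemma sig_eq_apply_of_vanishing (A : I → I → ℤ) (ι : ℕ → I) {x : ℕ →₀ ℤ} {k : ℕ}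
    (hx : ∀ j, k < j → x j = 0) : sig A ι k x = x k := by
  rw [sig, Finset.sum_eq_zero, add_zero]
  intro j hj
  rw [hx j (Finset.mem_filter.mp hj).2, mul_zero]

lemma kplus_spec {ι : ℕ → I} (hι : ∀ i : I, {k : ℕ | 1 ≤ k ∧ ι k = i}.Infinite) (k : ℕ) :
    k < kplus ι k ∧ ι (kplus ι k) = ι k := by
  have h : {l | k < l ∧ ι l = ι k}.Nonempty := by
    obtain ⟨l, hl, hkl⟩ := (hι (ι k)).exists_gt k
    exact ⟨l, hkl, hl.2⟩
  exact Nat.sInf_mem h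

lemma kminus_spec {ι : ℕ → I} {k : ℕ} (h : kminus ι k ≠ 0) :
    1 ≤ kminus ι k ∧ kminus ι k < k ∧ ι (kminus ι k) = ι k := by
  have hne : {l | 1 ≤ l ∧ l < k ∧ ι l = ι k}.Nonempty := by
    by_contra hne
    rw [Set.not_nonempty_iff_eq_empty] at hne
    exact h (by simp [kminus, hne])
  exact Nat.sSup_mem hne ⟨k, fun l hl => hl.2.1.le⟩

lemma evalAff_betaP {A : I → I → ℤ} (hA : ∀ i, A i i = 2) {ι : ℕ → I}
    (hι : ∀ i : I, {k : ℕ | 1 ≤ k ∧ ι k = i}.Infinite) (x : ℕ →₀ ℤ) (k : ℕ) :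
    evalAff (betaP A ι k) x = sig A ι k x - sig A ι (kplus ι k) x := by
  obtain ⟨h1, h2⟩ := kplus_spec hι k
  rw [sig_sub_sig hA x h1 h2.symm, evalAff_eq, betaP]
  simp only [map_add, map_sum, Finsupp.linearCombination_single, smul_eq_mul]
  ring

lemma evalAff_betaM_of_ne_zero {A : I → I → ℤ} (hA : ∀ i, A i i = 2) {ι : ℕ → I}
    (lam : I → ℤ) (x : ℕ →₀ ℤ) {k : ℕ} (h : kminus ι k ≠ 0) :
    evalAff (betaM A ι lam k) x = sig A ι (kminus ι k) x - sig A ι k x := by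
  obtain ⟨-, h1, h2⟩ := kminus_spec h
  rw [sig_sub_sig hA x h1 h2, evalAff_eq, betaM, if_neg h, h2]
  simp only [map_add, map_sum, Finsupp.linearCombination_single, smul_eq_mul]
  ring

lemma evalAff_betaM_of_eq_zero {A : I → I → ℤ} (hA : ∀ i, A i i = 2) {ι : ℕ → I}
    (lam : I → ℤ) (x : ℕ →₀ ℤ) {k : ℕ} (hk : 1 ≤ k) (h : kminus ι k = 0) :
    evalAff (betaM A ι lam k) x = sig0 A ι lam (ι k) x - sig A ι k x := by
  rw [sig0_sub_sig hA lam x hk, evalAff_eq, betaM, if_pos h]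
  simp only [map_add, map_sum, Finsupp.linearCombination_single, smul_eq_mul]
  ring

lemma sigMax_isGreatest {A : I → I → ℤ} {ι : ℕ → I}
    (hι : ∀ i : I, {k : ℕ | 1 ≤ k ∧ ι k = i}.Infinite) (i : I) (x : ℕ →₀ ℤ) :
    IsGreatest ((fun k => sig A ι k x) '' {k | 1 ≤ k ∧ ι k = i}) (sigMax A ι i x) := by
  have hne : ((fun k => sig A ι k x) '' {k | 1 ≤ k ∧ ι k = i}).Nonempty :=
    (hι i).nonempty.image _
  have hbdd : BddAbove ((fun k => sig A ι k x) '' {k | 1 ≤ k ∧ ι k = i}) := by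
    obtain ⟨N, -, hN⟩ := exists_vanishing_bound x 0
    refine (((Finset.range N).image fun k => sig A ι k x) ∪ {0}).bddAbove.mono ?_
    rintro _ ⟨k, -, rfl⟩
    rcases lt_or_ge k N with hk | hk
    · simp only [Finset.coe_union, Finset.coe_image, Finset.coe_range]
      exact Or.inl ⟨k, hk, rfl⟩
    · have : sig A ι k x = 0 := by
        rw [sig_eq_apply_of_vanishing A ι fun j hj => hN j (by omega), hN k hk]
      simp [this]
  exact ⟨Int.csSup_mem hne hbdd, fun _ h => le_csSup hbdd h⟩

lemma sig_le_sigMax {A : I → I → ℤ} {ι : ℕ → I}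
    (hι : ∀ i : I, {k : ℕ | 1 ≤ k ∧ ι k = i}.Infinite) (x : ℕ →₀ ℤ) {k : ℕ} (hk : 1 ≤ k) :
    sig A ι k x ≤ sigMax A ι (ι k) x :=
  (sigMax_isGreatest hι (ι k) x).2 ⟨k, ⟨hk, rfl⟩, rfl⟩

/-- `f̃_i` acts on `x` by raising the entry at position `k`. -/
structure RaisesAt (A : I → I → ℤ) (ι : ℕ → I) (lam : I → ℤ) (k : ℕ) (x : ℕ →₀ ℤ) : Prop where
  pos : 1 ≤ k
  sig0_lt : sig0 A ι lam (ι k) x < sig A ι k x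
  sig_le : ∀ l, 1 ≤ l → ι l = ι k → sig A ι l x ≤ sig A ι k x
  sig_lt : ∀ l, 1 ≤ l → ι l = ι k → l < k → sig A ι l x < sig A ι k x

lemma exists_raisesAt_of_ftil_eq_some {A : I → I → ℤ} {ι : ℕ → I} {lam : I → ℤ}
    (hι : ∀ i : I, {k : ℕ | 1 ≤ k ∧ ι k = i}.Infinite) {i : I} {x y : ℕ →₀ ℤ}
    (h : ftil A ι lam i (some x) = some y) :
    ∃ k, ι k = i ∧ RaisesAt A ι lam k x ∧ y = x + Finsupp.single k 1 := by
  obtain ⟨⟨k₀, hk₀, hk₀'⟩, hmax⟩ := sigMax_isGreatest (A := A) hι i x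
  have hmem : sInf (Mset A ι i x) ∈ Mset A ι i x := Nat.sInf_mem ⟨k₀, hk₀.1, hk₀.2, hk₀'⟩
  simp only [ftil] at h
  split_ifs at h with hlt
  obtain ⟨h1, h2, h3⟩ := hmem
  refine ⟨_, h2, ⟨h1, by rwa [h2, h3], ?_, ?_⟩, (Option.some.inj h).symm⟩
  · intro l hl hl'
    rw [h3]
    exact hmax ⟨l, ⟨hl, hl'.trans h2⟩, rfl⟩
  · intro l hl hl' hlk
    rw [h3]
    refine lt_of_le_of_ne (hmax ⟨l, ⟨hl, hl'.trans h2⟩, rfl⟩) fun he => ?_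
    exact absurd (Nat.sInf_le (show l ∈ Mset A ι i x from ⟨hl, hl'.trans h2, he⟩)) (by omega)

lemma RaisesAt.ftil_eq {A : I → I → ℤ} {ι : ℕ → I} {lam : I → ℤ}
    (hι : ∀ i : I, {k : ℕ | 1 ≤ k ∧ ι k = i}.Infinite) {k : ℕ} {x : ℕ →₀ ℤ}
    (h : RaisesAt A ι lam k x) :
    ftil A ι lam (ι k) (some x) = some (x + Finsupp.single k 1) := by
  have hmax : sigMax A ι (ι k) x = sig A ι k x := by
    refine (sigMax_isGreatest hι (ι k) x).unique ⟨⟨k, ⟨h.pos, rfl⟩, rfl⟩, ?_⟩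
    rintro _ ⟨l, hl, rfl⟩
    exact h.sig_le l hl.1 hl.2
  have hinf : sInf (Mset A ι (ι k) x) = k := by
    have hk : k ∈ Mset A ι (ι k) x := ⟨h.pos, rfl, hmax.symm⟩
    refine le_antisymm (Nat.sInf_le hk) ?_
    obtain ⟨h1, h2, h3⟩ := Nat.sInf_mem ⟨k, hk⟩
    by_contra hlt
    have := h.sig_lt _ h1 h2 (by omega)
    omega
  simp only [ftil]
  rw [if_pos (by rw [hmax]; exact h.sig0_lt), hinf]

lemma InSigma.nonneg {A : I → I → ℤ} {ι : ℕ → I} {lam : I → ℤ} {x : ℕ →₀ ℤ}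
    (hx : InSigma A ι lam x) {j : ℕ} (hj : 1 ≤ j) : 0 ≤ x j := by
  simpa [evalAff_eq] using hx _ (XiLam.coord j hj)

lemma InSigma.sig0_le_sigMax {A : I → I → ℤ} (hA : ∀ i, A i i = 2) {ι : ℕ → I} {lam : I → ℤ}
    (hι : ∀ i : I, {k : ℕ | 1 ≤ k ∧ ι k = i}.Infinite) {x : ℕ →₀ ℤ}
    (hx : InSigma A ι lam x) (i : I) : sig0 A ι lam i x ≤ sigMax A ι i x := by
  have h := hx _ (XiLam.lamgen i)
  obtain ⟨h1, h2⟩ : sInf {k | 1 ≤ k ∧ ι k = i} ∈ {k | 1 ≤ k ∧ ι k = i} :=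
    Nat.sInf_mem (hι i).nonempty
  rw [evalAff_eq, lamF] at h
  generalize sInf {k | 1 ≤ k ∧ ι k = i} = k at h h1 h2
  subst h2
  have h3 := sig0_sub_sig hA lam x (ι := ι) h1
  have h4 := sig_le_sigMax (A := A) hι x h1
  simp only [map_sub, map_neg, map_sum, Finsupp.linearCombination_single, smul_eq_mul,
    one_mul] at h
  linarith

lemma InSigma.add_single {A : I → I → ℤ} (hA : ∀ i, A i i = 2) {ι : ℕ → I} {lam : I → ℤ}
    {k : ℕ} {x : ℕ →₀ ℤ} (hx : InSigma A ι lam x) (h : RaisesAt A ι lam k x) :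
    InSigma A ι lam (x + Finsupp.single k 1) := by
  intro φ hφ
  rw [evalAff_add_single, mul_one]
  have h1 := hx φ hφ
  by_cases hk : 0 < φ.2 k
  · omega
  · have h2 := hx _ (XiLam.shat k h.pos φ hφ)
    rw [Shat, if_neg hk, evalAff_sub_smul] at h2
    have h3 : evalAff (betaM A ι lam k) x ≤ -1 := by
      by_cases hz : kminus ι k = 0
      · rw [evalAff_betaM_of_eq_zero hA lam x h.pos hz]
        linarith [Int.add_one_le_of_lt h.sig0_lt]
      · rw [evalAff_betaM_of_ne_zero hA lam x hz]
        obtain ⟨h4, h5, h6⟩ := kminus_spec hz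
        linarith [Int.add_one_le_of_lt (h.sig_lt _ h4 h6 h5)]
    nlinarith

lemma InSigma.sub_single {A : I → I → ℤ} (hA : ∀ i, A i i = 2) {ι : ℕ → I} {lam : I → ℤ}
    (hι : ∀ i : I, {k : ℕ | 1 ≤ k ∧ ι k = i}.Infinite) {k : ℕ} (hk1 : 1 ≤ k) {x : ℕ →₀ ℤ}
    (hx : InSigma A ι lam x) (h : ∀ l, ι l = ι k → k < l → sig A ι l x < sig A ι k x) :
    InSigma A ι lam (x + Finsupp.single k (-1)) := by
  intro φ hφ
  rw [evalAff_add_single]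
  have h1 := hx φ hφ
  by_cases hk : 0 < φ.2 k
  · have h2 := hx _ (XiLam.shat k hk1 φ hφ)
    rw [Shat, if_pos hk, evalAff_sub_smul, evalAff_betaP hA hι] at h2
    obtain ⟨h4, h5⟩ := kplus_spec hι k
    have h3 := Int.add_one_le_of_lt (h _ h5 h4)
    nlinarith
  · omega

lemma sum_filter_add_single (c : ℕ → ℤ) (p : ℕ → Prop) [DecidablePred p] (x : ℕ →₀ ℤ) (k : ℕ)
    (a : ℤ) :
    ∑ j ∈ (x + Finsupp.single k a).support.filter p, c j * (x + Finsupp.single k a) j =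
      ∑ j ∈ x.support.filter p, c j * x j + if p k then c k * a else 0 := by
  have key : ∀ z : ℕ →₀ ℤ, ∑ j ∈ z.support.filter p, c j * z j =
      Finsupp.linearCombination ℤ (fun j => if p j then c j else 0) z := by
    intro z
    rw [Finset.sum_filter, Finsupp.linearCombination_apply, Finsupp.sum]
    refine Finset.sum_congr rfl fun j _ => ?_
    split_ifs <;> simp [mul_comm]
  rw [key, key, map_add, Finsupp.linearCombination_single]
  split_ifs <;> simp [mul_comm]

lemma sig_add_single (A : I → I → ℤ) (ι : ℕ → I) (x : ℕ →₀ ℤ) (k l : ℕ) (a : ℤ) :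
    sig A ι l (x + Finsupp.single k a) =
      sig A ι l x + (if l = k then a else 0) + if l < k then A (ι l) (ι k) * a else 0 := by
  rw [sig, sig, sum_filter_add_single (fun j => A (ι l) (ι j)), Finsupp.add_apply,
    Finsupp.single_apply]
  simp only [eq_comm (a := k)]
  ring

/-- If `σ^{(i)}(x) > 0` at a point `x` of `Σ_ι[λ]`, then `x` is obtained by applying `f̃_i` to
another point of `Σ_ι[λ]`. -/
lemma InSigma.exists_raisesAt {A : I → I → ℤ} (hA : ∀ i, A i i = 2) {ι : ℕ → I} {lam : I → ℤ}
    (hι : ∀ i : I, {k : ℕ | 1 ≤ k ∧ ι k = i}.Infinite) {x : ℕ →₀ ℤ}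
    (hx : InSigma A ι lam x) {i : I} (hpos : 0 < sigMax A ι i x) :
    ∃ k, ι k = i ∧ 0 < sig A ι k x ∧ InSigma A ι lam (x + Finsupp.single k (-1)) ∧
      RaisesAt A ι lam k (x + Finsupp.single k (-1)) := by
  obtain ⟨⟨k₀, hk₀, hk₀'⟩, hmax⟩ := sigMax_isGreatest (A := A) hι i x
  obtain ⟨N, -, hN⟩ := exists_vanishing_bound x 0
  have hbdd : BddAbove (Mset A ι i x) := by
    refine ⟨N, fun k hk => ?_⟩
    by_contra hlt
    have h1 : sig A ι k x = 0 := by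
      rw [sig_eq_apply_of_vanishing A ι fun j hj => hN j (by omega), hN k (by omega)]
    have h2 := hk.2.2
    omega
  obtain ⟨h1, h2, h3⟩ : sSup (Mset A ι i x) ∈ Mset A ι i x :=
    Nat.sSup_mem ⟨k₀, hk₀.1, hk₀.2, hk₀'⟩ hbdd
  have hgt : ∀ l, ι l = i → sSup (Mset A ι i x) < l → sig A ι l x < sigMax A ι i x := by
    intro l hl hkl
    refine lt_of_le_of_ne (hmax ⟨l, ⟨by omega, hl⟩, rfl⟩) fun he => ?_
    exact absurd (le_csSup hbdd (show l ∈ Mset A ι i x from ⟨by omega, hl, he⟩)) (by omega)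
  have hsig0 := hx.sig0_le_sigMax hA hι i
  generalize sSup (Mset A ι i x) = k at h1 h2 h3 hgt
  subst h2
  have hk : sig A ι k (x + Finsupp.single k (-1)) = sig A ι k x - 1 := by
    rw [sig_add_single]
    simp
    ring
  have hlt : ∀ l, ι l = ι k → l < k →
      sig A ι l (x + Finsupp.single k (-1)) = sig A ι l x - 2 := by
    intro l hl hlk
    rw [sig_add_single, if_neg hlk.ne, if_pos hlk, hl, hA]
    ring
  refine ⟨k, rfl, by omega, hx.sub_single hA hι h1 (by rwa [h3]), h1, ?_, ?_, ?_⟩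
  · have : sig0 A ι lam (ι k) (x + Finsupp.single k (-1)) = sig0 A ι lam (ι k) x - 2 := by
      rw [sig0, sig0, sum_filter_add_single (fun j => A (ι k) (ι j)), if_pos h1, hA]
      ring
    omega
  · intro l hl hl'
    rcases lt_trichotomy l k with hlk | rfl | hlk
    · rw [hlt l hl' hlk, hk]
      have : sig A ι l x ≤ _ := hmax ⟨l, ⟨hl, hl'⟩, rfl⟩
      omega
    · exact le_rfl
    · rw [sig_add_single, if_neg hlk.ne', if_neg hlk.not_gt, hk]
      have := hgt l hl' hlk
      omega
  · intro l hl hl' hlk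
    rw [hlt l hl' hlk, hk]
    have : sig A ι l x ≤ _ := hmax ⟨l, ⟨hl, hl'⟩, rfl⟩
    omega

/-- The lattice points of `Σ_ι[λ]` supported in positions `1, …, L`. -/
def truncSigma (A : I → I → ℤ) (ι : ℕ → I) (lam : I → ℤ) (L : ℕ) : Set (ℕ →₀ ℤ) :=
  {x | x 0 = 0 ∧ InSigma A ι lam x ∧ ∀ k, L < k → x k = 0}

lemma mem_truncSigma_of_ftil {A : I → I → ℤ} (hA : ∀ i, A i i = 2) {ι : ℕ → I} {lam : I → ℤ}
    (hι : ∀ i : I, {k : ℕ | 1 ≤ k ∧ ι k = i}.Infinite) {L : ℕ} (hL : 1 ≤ L) {x y : ℕ →₀ ℤ}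
    (hx : x ∈ truncSigma A ι lam L) (h : ftil A ι lam (ι L) (some x) = some y) :
    y ∈ truncSigma A ι lam L := by
  obtain ⟨k, hk, hr, rfl⟩ := exists_raisesAt_of_ftil_eq_some hι h
  obtain ⟨hx0, hxS, hxL⟩ := hx
  have hpos := hr.pos
  have hkL : k ≤ L := by
    by_contra hlt
    have h1 := hr.sig_lt L hL hk.symm (by omega)
    rw [sig_eq_apply_of_vanishing A ι hxL,
      sig_eq_apply_of_vanishing A ι fun j hj => hxL j (by omega), hxL k (by omega)] at h1
    have := hxS.nonneg hL
    omega
  refine ⟨?_, hxS.add_single hA hr, fun j hj => ?_⟩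
  · rw [Finsupp.add_apply, hx0, Finsupp.single_apply, if_neg (by omega), add_zero]
  · rw [Finsupp.add_apply, hxL j hj, Finsupp.single_apply, if_neg (by omega), add_zero]

lemma mem_truncSigma_of_iterate_ftil {A : I → I → ℤ} (hA : ∀ i, A i i = 2) {ι : ℕ → I}
    {lam : I → ℤ} (hι : ∀ i : I, {k : ℕ | 1 ≤ k ∧ ι k = i}.Infinite) {L : ℕ} (hL : 1 ≤ L)
    {x : ℕ →₀ ℤ} (hx : x ∈ truncSigma A ι lam L) (m : ℕ) (y : ℕ →₀ ℤ)
    (h : (ftil A ι lam (ι L))^[m] (some x) = some y) : y ∈ truncSigma A ι lam L := by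
  induction m generalizing y with
  | zero =>
    obtain rfl : x = y := Option.some.inj h
    exact hx
  | succ m ih =>
    rw [Function.iterate_succ_apply'] at h
    rcases hz : (ftil A ι lam (ι L))^[m] (some x) with _ | z
    · simp [hz, ftil] at h
    · rw [hz] at h
      exact mem_truncSigma_of_ftil hA hι hL (ih z hz) h

lemma exists_iterate_ftil_eq {A : I → I → ℤ} (hA : ∀ i, A i i = 2) {ι : ℕ → I}
    {lam : I → ℤ} (hι : ∀ i : I, {k : ℕ | 1 ≤ k ∧ ι k = i}.Infinite) {L : ℕ} (n : ℕ)
    (x : ℕ →₀ ℤ) (hx : x ∈ truncSigma A ι lam (L + 1))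
    (hn : ∑ j ∈ Finset.range (L + 2), x j ≤ n) :
    ∃ m, ∃ y ∈ truncSigma A ι lam L,
      (ftil A ι lam (ι (L + 1)))^[m] (some y) = some x := by
  induction n generalizing x with
  | zero =>
    obtain ⟨hx0, hxS, hxL⟩ := hx
    have hnn : ∀ j ∈ Finset.range (L + 2), 0 ≤ x j := by
      intro j _
      rcases Nat.eq_zero_or_pos j with rfl | hj
      · exact hx0.ge
      · exact hxS.nonneg hj
    refine ⟨0, x, ⟨hx0, hxS, fun k hk => ?_⟩, rfl⟩
    rcases (show L + 1 = k ∨ L + 1 < k by omega) with rfl | hk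
    · have := Finset.single_le_sum hnn (Finset.mem_range.mpr (show L + 1 < L + 2 by omega))
      have := hxS.nonneg (j := L + 1) (by omega)
      push_cast at hn
      omega
    · exact hxL k hk
  | succ n ih =>
    obtain ⟨hx0, hxS, hxL⟩ := hx
    by_cases hpos : 0 < sigMax A ι (ι (L + 1)) x
    · obtain ⟨k, hk, hsig, hS, hr⟩ := hxS.exists_raisesAt hA hι hpos
      have hk1 := hr.pos
      have hkL : k ≤ L + 1 := by
        by_contra hlt
        rw [sig_eq_apply_of_vanishing A ι fun j hj => hxL j (by omega), hxL k (by omega)] at hsig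
        omega
      have hmem : x + Finsupp.single k (-1) ∈ truncSigma A ι lam (L + 1) := by
        refine ⟨?_, hS, fun j hj => ?_⟩
        · rw [Finsupp.add_apply, hx0, Finsupp.single_apply, if_neg (by omega), add_zero]
        · rw [Finsupp.add_apply, hxL j hj, Finsupp.single_apply, if_neg (by omega), add_zero]
      have hsum : ∑ j ∈ Finset.range (L + 2), (x + Finsupp.single k (-1) : ℕ →₀ ℤ) j ≤ n := by
        have hk' : k < L + 2 := by omega
        simp only [Finsupp.add_apply, Finset.sum_add_distrib, Finsupp.single_apply,
          Finset.sum_ite_eq, Finset.mem_range, if_pos hk']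
        push_cast at hn
        linarith
      obtain ⟨m, y, hy, hm⟩ := ih _ hmem hsum
      refine ⟨m + 1, y, hy, ?_⟩
      rw [Function.iterate_succ_apply', hm, ← hk, hr.ftil_eq hι, add_assoc,
        ← Finsupp.single_add]
      simp
    · refine ⟨0, x, ⟨hx0, hxS, fun k hk => ?_⟩, rfl⟩
      rcases (show L + 1 = k ∨ L + 1 < k by omega) with rfl | hk
      · have h1 := sig_le_sigMax (A := A) hι x (k := L + 1) (by omega)
        rw [sig_eq_apply_of_vanishing A ι hxL] at h1
        have := hxS.nonneg (j := L + 1) (by omega)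
        omega
      · exact hxL k hk

lemma dem_eq_truncSigma {A : I → I → ℤ} (hA : ∀ i, A i i = 2) {ι : ℕ → I} {lam : I → ℤ}
    (hι : ∀ i : I, {k : ℕ | 1 ≤ k ∧ ι k = i}.Infinite) (hample : InSigma A ι lam 0) (L : ℕ) :
    Dem A ι lam L = truncSigma A ι lam L := by
  induction L with
  | zero =>
    ext x
    simp only [Dem, Set.mem_singleton_iff]
    constructor
    · rintro rfl
      exact ⟨rfl, hample, fun _ _ => rfl⟩
    · rintro ⟨h0, -, h⟩
      ext k
      rcases Nat.eq_zero_or_pos k with rfl | hk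
      · exact h0
      · exact h k hk
  | succ L ih =>
    ext y
    simp only [Dem, ih]
    constructor
    · rintro ⟨m, x, ⟨hx0, hxS, hxL⟩, h⟩
      exact mem_truncSigma_of_iterate_ftil hA hι (by omega)
        ⟨hx0, hxS, fun k hk => hxL k (by omega)⟩ m y h
    · intro hy
      exact exists_iterate_ftil_eq hA hι _ y hy (Int.self_le_toNat _)

/-- If `(ι, λ)` is ample (`0̄ ∈ Σ_ι[λ]`) and `w = s_{i_L}⋯s_{i_1}` is a reduced
word whose letters are the first `L` terms of `ι`, then the Demazure subset `D_L` is the set of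
lattice points of a convex polytope:
`D_L = { x ∈ ℤ^∞ : φ(x) ≥ 0 for all φ ∈ Ξ_ι[λ], x_k = 0 for k > L }`. -/
theorem demazure_polytope_ample {I : Type*} [Fintype I] [DecidableEq I]
    (A : I → I → ℤ)
    (hAdiag : ∀ i, A i i = 2)
    (hAoff : ∀ i j, i ≠ j → A i j ≤ 0)
    (hAzero : ∀ i j, A i j = 0 ↔ A j i = 0)
    (hAsym : ∃ d : I → ℤ, (∀ i, 0 < d i) ∧ ∀ i j, d i * A i j = d j * A j i)
    (ι : ℕ → I)
    (hι₁ : ∀ k, 1 ≤ k → ι k ≠ ι (k + 1))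
    (hι₂ : ∀ i : I, {k : ℕ | 1 ≤ k ∧ ι k = i}.Infinite)
    (lam : I → ℤ) (hlam : ∀ i, 0 ≤ lam i)
    (hample : ∀ φ, XiLam A ι lam φ → 0 ≤ evalAff φ 0)
    (L : ℕ)
    (hred : (coxOf A).toCoxeterSystem.IsReduced (demWord ι L)) :
    Dem A ι lam L =
      {x : ℕ →₀ ℤ | x 0 = 0 ∧ (∀ φ, XiLam A ι lam φ → 0 ≤ evalAff φ x) ∧
        ∀ k, L < k → x k = 0} :=
  dem_eq_truncSigma hAdiag hι₂ hample L

end PaperNakashima
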